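/- Let M be any real matrix with p columns and set V(β) = ‖M(β − B̂)‖² for β ∈ ℝ^p. Then for every β ∈ ℝ^p, ∫_{ℝ^p} V(β') k_AC(β,β') dβ' ≤ sup_{t ∈ (0,1)} ‖ M Σ⁻¹ Xᵀ D(B̂ + t(β−B̂)) X (β−B̂) ‖² + 2·tr( M Σ⁻¹ Mᵀ ). -/

import Mathlib

open MeasureTheory Matrix Filter

noncomputable section

/-- standard normal pdf -/
def nphi (x : ℝ) : ℝ := (Real.sqrt (2 * Real.pi))⁻¹ * Real.exp (-(x ^ 2) / 2)

/-- standard normal cdf -/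
def nPhi (x : ℝ) : ℝ := ∫ t in Set.Iic x, nphi t

/-- density of TN(θ,1;1) (if b = true) resp. TN(θ,1;0) (if b = false) at z -/
def tn (θ : ℝ) (b : Bool) (z : ℝ) : ℝ :=
  if b then (if 0 < z then nphi (z - θ) / nPhi θ else 0)
  else (if z < 0 then nphi (z - θ) / (1 - nPhi θ) else 0)

/-- p-variate Gaussian density with mean μ and covariance matrix Λ -/
def mvn {p : ℕ} (μ : Fin p → ℝ) (Λ : Matrix (Fin p) (Fin p) ℝ) (x : Fin p → ℝ) : ℝ :=
  Real.sqrt (((2 * Real.pi) ^ p * Λ.det)⁻¹) *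
    Real.exp (-(dotProduct (x - μ) (Λ⁻¹.mulVec (x - μ))) / 2)

/-- squared Euclidean norm -/
def normSq {m : ℕ} (x : Fin m → ℝ) : ℝ := ∑ i, x i ^ 2

/-- Albert and Chib's Markov transition density, with Σ = XᵀX + Q -/
def kAC {n p : ℕ} (X : Matrix (Fin n) (Fin p) ℝ) (Y : Fin n → Bool)
    (v : Fin p → ℝ) (Q : Matrix (Fin p) (Fin p) ℝ) (β β' : Fin p → ℝ) : ℝ :=
  ∫ z : Fin n → ℝ,
    mvn ((Xᵀ * X + Q)⁻¹.mulVec (Xᵀ.mulVec z + Q.mulVec v)) (Xᵀ * X + Q)⁻¹ β' *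
      ∏ i, tn (dotProduct (X i) β) (Y i) (z i)

/-- the defining property of the posterior mode B̂ -/
def IsPosteriorMode {n p : ℕ} (X : Matrix (Fin n) (Fin p) ℝ) (Y : Fin n → Bool)
    (v : Fin p → ℝ) (Q : Matrix (Fin p) (Fin p) ℝ) (Bhat : Fin p → ℝ) : Prop :=
  (∑ i, (if Y i then nphi (dotProduct (X i) Bhat) / nPhi (dotProduct (X i) Bhat)
          else -(nphi (dotProduct (X i) Bhat) / (1 - nPhi (dotProduct (X i) Bhat)))) • X i)
    - Q.mulVec (Bhat - v) = 0

/-- g(θ) = θφ(θ)/Φ(θ) + (φ(θ)/Φ(θ))² -/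
def gfun (θ : ℝ) : ℝ := θ * nphi θ / nPhi θ + (nphi θ / nPhi θ) ^ 2

/-- the diagonal matrix D(β) -/
def Dmat {n p : ℕ} (X : Matrix (Fin n) (Fin p) ℝ) (Y : Fin n → Bool) (β : Fin p → ℝ) :
    Matrix (Fin n) (Fin n) ℝ :=
  Matrix.diagonal fun i =>
    1 - (if Y i then gfun (dotProduct (X i) β) else gfun (-(dotProduct (X i) β)))


lemma nphi_nonneg (x : ℝ) : 0 ≤ nphi x := by unfold nphi; positivity

lemma nphi_pos (x : ℝ) : 0 < nphi x := by unfold nphi; positivity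

lemma nphi_neg (x : ℝ) : nphi (-x) = nphi x := by unfold nphi; simp

lemma nphi_cont : Continuous nphi := by unfold nphi; fun_prop

lemma nphi_deriv (x : ℝ) : HasDerivAt nphi (-x * nphi x) x := by
  have h : HasDerivAt (fun x : ℝ => -(x ^ 2) / 2) (-x) x := by
    have := ((hasDerivAt_pow 2 x).neg).div_const 2
    convert! this using 1
    simp
    ring
  have := (h.exp).const_mul (Real.sqrt (2 * Real.pi))⁻¹
  unfold nphi
  convert! this using 1
  ring

lemma nphi_eq (x : ℝ) : nphi x = (Real.sqrt (2 * Real.pi))⁻¹ * Real.exp (-(1/2) * x ^ 2) := by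
  unfold nphi; congr 2; ring

lemma nphi_int : Integrable nphi := by
  have := (integrable_exp_neg_mul_sq (b := 1/2) (by norm_num)).const_mul (Real.sqrt (2 * Real.pi))⁻¹
  exact this.congr (ae_of_all _ fun x => (nphi_eq x).symm)

lemma nphi_int1 : Integrable (fun x => x * nphi x) := by
  have := (integrable_mul_exp_neg_mul_sq (b := 1/2) (by norm_num)).const_mul (Real.sqrt (2 * Real.pi))⁻¹
  refine this.congr (ae_of_all _ fun x => ?_)
  simp only [nphi_eq]; ring

lemma nphi_int2 : Integrable (fun x => x ^ 2 * nphi x) := by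
  have := (integrable_rpow_mul_exp_neg_mul_sq (b := 1/2) (by norm_num) (s := 2) (by norm_num)).const_mul (Real.sqrt (2 * Real.pi))⁻¹
  refine this.congr (ae_of_all _ fun x => ?_)
  simp only [nphi_eq, Real.rpow_two]; ring

lemma nphi_integral : ∫ x, nphi x = 1 := by
  simp_rw [nphi_eq]
  rw [integral_const_mul, integral_gaussian]
  have : Real.pi / (1/2) = 2 * Real.pi := by ring
  rw [this]
  have : 0 < Real.sqrt (2 * Real.pi) := by positivity
  field_simp

lemma nphi_integral1 : ∫ x, x * nphi x = 0 := by
  have := integral_eq_zero_of_hasDerivAt_of_integrable (f := fun x => - nphi x) (f' := fun x => x * nphi x)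
    (fun x => by convert! (nphi_deriv x).neg using 1; ring) nphi_int1 nphi_int.neg
  exact this

lemma nphi_integral2 : ∫ x, x ^ 2 * nphi x = 1 := by
  have := integral_eq_zero_of_hasDerivAt_of_integrable (f := fun x => - (x * nphi x))
    (f' := fun x => x ^ 2 * nphi x - nphi x)
    (fun x => by
      have := ((hasDerivAt_id x).mul (nphi_deriv x)).neg
      convert! this using 1
      simp; ring) (nphi_int2.sub nphi_int) nphi_int1.neg
  rw [integral_sub nphi_int2 nphi_int, nphi_integral] at this
  linarith

lemma nPhi_deriv (x : ℝ) : HasDerivAt nPhi (nphi x) x := by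
  have h : nPhi = fun y => nPhi 0 + ∫ t in (0:ℝ)..y, nphi t := by
    funext y
    have := intervalIntegral.integral_Iic_sub_Iic (nphi_int.integrableOn (s := Set.Iic 0))
      (nphi_int.integrableOn (s := Set.Iic y))
    unfold nPhi
    rw [← this]; ring
  rw [h]
  exact (nphi_cont.integral_hasStrictDerivAt 0 x).hasDerivAt.const_add _

lemma nPhi_pos (x : ℝ) : 0 < nPhi x := by
  unfold nPhi
  rw [setIntegral_pos_iff_support_of_nonneg_ae (ae_of_all _ nphi_nonneg) nphi_int.integrableOn]
  have : Function.support nphi = Set.univ := by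
    ext y; simp [(nphi_pos y).ne']
  rw [this]; simp

lemma one_sub_nPhi (x : ℝ) : 1 - nPhi x = nPhi (-x) := by
  have h1 : nPhi (-x) = ∫ t in Set.Ioi x, nphi t := by
    unfold nPhi
    have := integral_comp_neg_Iic (-x) nphi
    simp only [nphi_neg, neg_neg] at this
    exact this
  have h2 := integral_add_compl (measurableSet_Iic (a := x)) nphi_int
  rw [Set.compl_Iic, nphi_integral] at h2
  rw [h1, ← h2]; unfold nPhi; ring

lemma nPhi_Ioi (θ : ℝ) : ∫ z in Set.Ioi (0:ℝ), nphi (z - θ) = nPhi θ := by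
  have h := integral_comp_neg_Iic (0) (fun z => nphi (z - θ))
  have h1 : ∀ x, nphi (-x - θ) = nphi (x + θ) := fun x => by rw [← nphi_neg]; congr 1; ring
  simp only [h1, neg_zero] at h
  rw [← h]
  unfold nPhi
  rw [← integral_indicator measurableSet_Iic, ← integral_indicator measurableSet_Iic,
    ← integral_add_right_eq_self (μ := volume) (Set.indicator (Set.Iic θ) nphi) θ]
  congr 1; funext x
  simp [Set.indicator]

lemma sint0 (θ : ℝ) : Integrable (fun z => nphi (z - θ)) := nphi_int.comp_sub_right θ
lemma sint1 (θ : ℝ) : Integrable (fun z => z * nphi (z - θ)) := by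
  have := (nphi_int1.comp_sub_right θ).add ((sint0 θ).const_mul θ)
  refine this.congr (ae_of_all _ fun x => ?_)
  simp; ring
lemma sint2 (θ : ℝ) : Integrable (fun z => z ^ 2 * nphi (z - θ)) := by
  have := ((nphi_int2.comp_sub_right θ).add ((sint1 θ).const_mul (2 * θ))).sub ((sint0 θ).const_mul (θ ^ 2))
  refine this.congr (ae_of_all _ fun x => ?_)
  simp; ring

lemma sderiv (θ z : ℝ) : HasDerivAt (fun z => nphi (z - θ)) (-(z - θ) * nphi (z - θ)) z :=
  HasDerivAt.comp_sub_const z θ (nphi_deriv (z - θ))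

lemma nPhi_Ioi1 (θ : ℝ) : ∫ z in Set.Ioi (0:ℝ), z * nphi (z - θ) = θ * nPhi θ + nphi θ := by
  have hd : ∀ z ∈ Set.Ici (0:ℝ), HasDerivAt (fun z => - nphi (z - θ))
      (z * nphi (z - θ) - θ * nphi (z - θ)) z := fun z _ => by
    convert! (sderiv θ z).neg using 1; ring
  have hi := (sint1 θ).sub ((sint0 θ).const_mul θ)
  have := integral_Ioi_of_hasDerivAt_of_tendsto' hd hi.integrableOn
    (tendsto_zero_of_hasDerivAt_of_integrableOn_Ioi (a := 0) (fun z hz => hd z (Set.mem_Ici.2 (le_of_lt hz)))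
      hi.integrableOn (sint0 θ).neg.integrableOn)
  rw [integral_sub (sint1 θ).integrableOn ((sint0 θ).const_mul θ).integrableOn,
    integral_const_mul, nPhi_Ioi] at this
  simp only [zero_sub, nphi_neg] at this
  linarith

lemma nPhi_Ioi2 (θ : ℝ) : ∫ z in Set.Ioi (0:ℝ), z ^ 2 * nphi (z - θ) =
    θ * (θ * nPhi θ + nphi θ) + nPhi θ := by
  have hd : ∀ z ∈ Set.Ici (0:ℝ), HasDerivAt (fun z => - (z * nphi (z - θ)))
      (z ^ 2 * nphi (z - θ) - (θ * (z * nphi (z - θ)) + nphi (z - θ))) z := fun z _ => by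
    convert! ((hasDerivAt_id z).mul (sderiv θ z)).neg using 1; simp; ring
  have hi := (sint2 θ).sub (((sint1 θ).const_mul θ).add (sint0 θ))
  have := integral_Ioi_of_hasDerivAt_of_tendsto' hd hi.integrableOn
    (tendsto_zero_of_hasDerivAt_of_integrableOn_Ioi (a := 0) (fun z hz => hd z (Set.mem_Ici.2 (le_of_lt hz)))
      hi.integrableOn (sint1 θ).neg.integrableOn)
  have hadd : Integrable (fun z => θ * (z * nphi (z - θ)) + nphi (z - θ)) := ((sint1 θ).const_mul θ).add (sint0 θ)
  rw [integral_sub (sint2 θ).integrableOn hadd.integrableOn,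
    integral_add ((sint1 θ).const_mul θ).integrableOn (sint0 θ).integrableOn,
    integral_const_mul, nPhi_Ioi, nPhi_Ioi1] at this
  simp only [zero_mul, neg_zero, sub_zero] at this
  linarith

/-- mean of the truncated normal -/
def tmean (θ : ℝ) (b : Bool) : ℝ :=
  θ + (if b then nphi θ / nPhi θ else -(nphi θ / (1 - nPhi θ)))

lemma tmean_false (θ : ℝ) : tmean θ false = - tmean (-θ) true := by
  simp [tmean, one_sub_nPhi, nphi_neg]; ring

lemma tn_true (θ z : ℝ) : tn θ true z = (Set.Ioi (0:ℝ)).indicator (fun z => nphi (z - θ)) z / nPhi θ := by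
  by_cases h : 0 < z <;> simp [tn, h]

lemma tn_true' (u : ℝ → ℝ) (θ z : ℝ) : u z * tn θ true z =
    (Set.Ioi (0:ℝ)).indicator (fun z => u z * nphi (z - θ)) z / nPhi θ := by
  by_cases h : 0 < z <;> simp [tn, h]; ring

lemma tn_false (θ z : ℝ) : tn θ false z = tn (-θ) true (-z) := by
  have : nphi (-z + θ) = nphi (z - θ) := by rw [← nphi_neg]; congr 1; ring
  simp [tn, one_sub_nPhi, this]

lemma tn_nonneg (θ : ℝ) (b : Bool) (z : ℝ) : 0 ≤ tn θ b z := by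
  have := nphi_nonneg (z - θ)
  have := nPhi_pos θ
  have := nPhi_pos (-θ)
  unfold tn; rw [one_sub_nPhi]; split_ifs <;> positivity

lemma tn_meas (θ : ℝ) (b : Bool) : Measurable (tn θ b) := by
  have := nphi_cont.measurable
  unfold tn
  cases b
  · simp only [Bool.false_eq_true, if_false]
    exact Measurable.ite measurableSet_Iio (by fun_prop) measurable_const
  · simp only [if_true]
    exact Measurable.ite measurableSet_Ioi (by fun_prop) measurable_const

lemma tn_true_gen (u : ℝ → ℝ) (θ : ℝ) (h : Integrable (fun z => u z * nphi (z - θ))) :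
    Integrable (fun z => u z * tn θ true z) ∧
    ∫ z, u z * tn θ true z = (∫ z in Set.Ioi (0:ℝ), u z * nphi (z - θ)) / nPhi θ := by
  simp_rw [tn_true']
  exact ⟨(h.indicator measurableSet_Ioi).div_const _, by
    rw [integral_div, integral_indicator measurableSet_Ioi]⟩

lemma tn_facts_true (θ : ℝ) :
    (Integrable (fun z => tn θ true z) ∧ ∫ z, tn θ true z = 1) ∧
    (Integrable (fun z => z * tn θ true z) ∧ ∫ z, z * tn θ true z = tmean θ true) ∧
    (Integrable (fun z => z ^ 2 * tn θ true z) ∧ ∫ z, z ^ 2 * tn θ true z = 1 + θ * tmean θ true) := by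
  have hp := (nPhi_pos θ).ne'
  refine ⟨?_, ?_, ?_⟩
  · have := tn_true_gen (fun _ => 1) θ (by simpa using sint0 θ)
    simp only [one_mul, nPhi_Ioi, div_self hp] at this
    exact this
  · have := tn_true_gen (fun z => z) θ (sint1 θ)
    rw [nPhi_Ioi1] at this
    refine ⟨this.1, this.2.trans ?_⟩
    simp [tmean]; field_simp
  · have := tn_true_gen (fun z => z ^ 2) θ (sint2 θ)
    rw [nPhi_Ioi2] at this
    refine ⟨this.1, this.2.trans ?_⟩
    simp [tmean]; field_simp; ring

lemma tn_facts (θ : ℝ) (b : Bool) :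
    (Integrable (fun z => tn θ b z) ∧ ∫ z, tn θ b z = 1) ∧
    (Integrable (fun z => z * tn θ b z) ∧ ∫ z, z * tn θ b z = tmean θ b) ∧
    (Integrable (fun z => z ^ 2 * tn θ b z) ∧ ∫ z, z ^ 2 * tn θ b z = 1 + θ * tmean θ b) := by
  cases b
  · obtain ⟨⟨a1, a2⟩, ⟨b1, b2⟩, ⟨c1, c2⟩⟩ := tn_facts_true (-θ)
    simp_rw [tn_false, tmean_false]
    refine ⟨⟨a1.comp_neg, ?_⟩, ⟨?_, ?_⟩, ⟨?_, ?_⟩⟩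
    · rw [integral_neg_eq_self (fun z => tn (-θ) true z)]; exact a2
    · refine b1.comp_neg.neg.congr (ae_of_all _ fun x => ?_); simp
    · rw [← b2, ← integral_neg_eq_self, ← integral_neg]; simp
    · refine c1.comp_neg.congr (ae_of_all _ fun x => ?_); simp
    · rw [mul_neg, ← neg_mul, ← c2, ← integral_neg_eq_self]; simp
  · exact tn_facts_true θ

lemma tmean_true_nonneg (θ : ℝ) : 0 ≤ tmean θ true := by
  rw [← (tn_facts_true θ).2.1.2]
  refine integral_nonneg fun z => ?_
  by_cases h : 0 < z
  · exact mul_nonneg h.le (tn_nonneg _ _ _)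
  · simp [tn, h]

/-- variance of the truncated normal -/
def tvar (θ : ℝ) (b : Bool) : ℝ := 1 + θ * tmean θ b - tmean θ b ^ 2

lemma tvar_true_le (θ : ℝ) : tvar θ true ≤ 1 := by
  have h := tmean_true_nonneg θ
  have h2 : 0 ≤ tmean θ true - θ := by
    have := nphi_nonneg θ
    have := nPhi_pos θ
    simp [tmean]; positivity
  unfold tvar
  nlinarith [mul_nonneg h h2]

lemma tvar_le (θ : ℝ) (b : Bool) : tvar θ b ≤ 1 := by
  cases b
  · have := tvar_true_le (-θ)
    unfold tvar at *
    rw [tmean_false]; linarith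
  · exact tvar_true_le θ

lemma tmean_deriv_true (θ : ℝ) : HasDerivAt (fun t => tmean t true) (1 - gfun θ) θ := by
  have h := (hasDerivAt_id θ).add ((nphi_deriv θ).div (nPhi_deriv θ) (nPhi_pos θ).ne')
  have hp := (nPhi_pos θ).ne'
  simp only [tmean, if_true]
  convert! h using 1
  unfold gfun; field_simp; ring

lemma tmean_deriv (θ : ℝ) (b : Bool) : HasDerivAt (fun t => tmean t b)
    (1 - (if b then gfun θ else gfun (-θ))) θ := by
  cases b
  · simp only [tmean_false]
    have := ((tmean_deriv_true (-θ)).scomp θ (hasDerivAt_neg θ)).neg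
    convert! this using 1
    simp
  · simpa using tmean_deriv_true θ

lemma gfun_cont : Continuous gfun := by
  have h1 := nphi_cont
  have h2 : Continuous nPhi := continuous_iff_continuousAt.2 fun x => (nPhi_deriv x).continuousAt
  have h3 : ∀ x, nPhi x ≠ 0 := fun x => (nPhi_pos x).ne'
  unfold gfun
  fun_prop (disch := assumption)

/-- `g` is integrable with integral `c` -/
def HI {n : ℕ} (g : (Fin n → ℝ) → ℝ) (c : ℝ) : Prop := Integrable g ∧ ∫ z, g z = c

lemma HI.add {n : ℕ} {g h : (Fin n → ℝ) → ℝ} {c d : ℝ} (hg : HI g c) (hh : HI h d) :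
    HI (fun z => g z + h z) (c + d) :=
  ⟨hg.1.add hh.1, by rw [integral_add hg.1 hh.1, hg.2, hh.2]⟩

lemma HI.mul {n : ℕ} {g : (Fin n → ℝ) → ℝ} {c : ℝ} (a : ℝ) (hg : HI g c) :
    HI (fun z => a * g z) (a * c) :=
  ⟨hg.1.const_mul a, by rw [integral_const_mul, hg.2]⟩

lemma HI.sum {n k : ℕ} {g : Fin k → (Fin n → ℝ) → ℝ} {c : Fin k → ℝ} (hg : ∀ i, HI (g i) (c i)) :
    HI (fun z => ∑ i, g i z) (∑ i, c i) :=
  ⟨integrable_finsetSum _ fun i _ => (hg i).1, by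
    rw [integral_finsetSum _ fun i _ => (hg i).1]; simp [fun i => (hg i).2]⟩

lemma HI.prod {n : ℕ} {f : Fin n → ℝ → ℝ} {c : Fin n → ℝ} (h : ∀ i, Integrable (f i) ∧ ∫ x, f i x = c i) :
    HI (fun z => ∏ i, f i (z i)) (∏ i, c i) :=
  ⟨Integrable.fintype_prod fun i => (h i).1, by
    rw [integral_fintype_prod_volume_eq_prod]; simp [fun i => (h i).2]⟩

lemma HI.congr {n : ℕ} {g h : (Fin n → ℝ) → ℝ} {c d : ℝ} (hg : HI g c) (e : ∀ z, g z = h z) (e' : c = d) :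
    HI h d := by
  have : g = h := funext e
  rw [← this, ← e']; exact hg

lemma moment {n k : ℕ} (f : Fin n → ℝ → ℝ) (m s : Fin n → ℝ)
    (h0 : ∀ i, Integrable (f i) ∧ ∫ x, f i x = 1)
    (h1 : ∀ i, Integrable (fun x => x * f i x) ∧ ∫ x, x * f i x = m i)
    (h2 : ∀ i, Integrable (fun x => x ^ 2 * f i x) ∧ ∫ x, x ^ 2 * f i x = s i + m i ^ 2)
    (A : Matrix (Fin k) (Fin n) ℝ) (b : Fin k → ℝ) :
    HI (fun z => normSq (A.mulVec z + b) * ∏ i, f i (z i))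
      (normSq (A.mulVec m + b) + ∑ r, ∑ i, A r i ^ 2 * s i) := by
  classical
  have E0 : HI (fun z => ∏ i, f i (z i)) 1 := by
    refine (HI.prod h0).congr (fun z => rfl) (by simp)
  have E1 : ∀ i, HI (fun z => z i * ∏ l, f l (z l)) (m i) := by
    intro i
    refine (HI.prod (f := fun l x => (if l = i then x else 1) * f l x)
      (c := fun l => if l = i then m l else 1) fun l => ?_).congr (fun z => ?_) ?_
    · by_cases h : l = i
      · simpa [h] using h1 i
      · simpa [h] using h0 l
    · rw [Finset.prod_mul_distrib]; simp
    · simp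
  have E2 : ∀ i j, HI (fun z => z i * z j * ∏ l, f l (z l)) (m i * m j + if i = j then s i else 0) := by
    intro i j
    by_cases hij : i = j
    · subst hij
      refine (HI.prod (f := fun l x => (if l = i then x ^ 2 else 1) * f l x)
        (c := fun l => if l = i then s l + m l ^ 2 else 1) fun l => ?_).congr (fun z => ?_) ?_
      · by_cases h : l = i
        · simpa [h] using h2 i
        · simpa [h] using h0 l
      · rw [Finset.prod_mul_distrib]; simp [sq]
      · simp; ring
    · refine (HI.prod (f := fun l x => ((if l = i then x else 1) * (if l = j then x else 1)) * f l x)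
        (c := fun l => (if l = i then m l else 1) * (if l = j then m l else 1)) fun l => ?_).congr
          (fun z => ?_) ?_
      · by_cases h : l = i
        · subst h; simpa [hij] using h1 l
        · by_cases h' : l = j
          · subst h'; simpa [h] using h1 l
          · simpa [h, h'] using h0 l
      · rw [Finset.prod_mul_distrib, Finset.prod_mul_distrib]; simp
      · rw [Finset.prod_mul_distrib]; simp [hij]
  have ER : ∀ r, HI (fun z => ((∑ i, A r i * z i) + b r) ^ 2 * ∏ l, f l (z l))
      (((∑ i, A r i * m i) + b r) ^ 2 + ∑ i, A r i ^ 2 * s i) := by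
    intro r
    have key := ((HI.sum fun i => HI.sum fun j => (E2 i j).mul (A r i * A r j)).add
      ((HI.sum fun i => (E1 i).mul (A r i)).mul (2 * b r))).add (E0.mul (b r ^ 2))
    refine key.congr (fun z => ?_) ?_
    · rw [add_sq, add_mul, add_mul, sq (∑ i, A r i * z i), Finset.sum_mul_sum]
      congr 1
      congr 1
      · rw [Finset.sum_mul]
        refine Finset.sum_congr rfl fun i _ => ?_
        rw [Finset.sum_mul]
        refine Finset.sum_congr rfl fun j _ => ?_
        ring
      · simp only [← mul_assoc]
        rw [← Finset.sum_mul]; ring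
    · simp only [mul_add, Finset.sum_add_distrib]
      rw [add_sq, sq (∑ i, A r i * m i), Finset.sum_mul_sum]
      have a1 : ∑ i, ∑ j, A r i * A r j * (m i * m j) = ∑ i, ∑ j, A r i * m i * (A r j * m j) :=
        Finset.sum_congr rfl fun i _ => Finset.sum_congr rfl fun j _ => by ring
      have a2 : ∑ i, ∑ j, A r i * A r j * (if i = j then s i else 0) = ∑ i, A r i ^ 2 * s i := by
        simp [sq]
      rw [a1, a2]; ring
  refine (HI.sum ER).congr (fun z => ?_) ?_
  · simp only [normSq, Finset.sum_mul, Pi.add_apply, Matrix.mulVec, dotProduct]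
  · simp only [normSq, Finset.sum_add_distrib, Pi.add_apply, Matrix.mulVec, dotProduct]

lemma gauss_change {p : ℕ} (L : Matrix (Fin p) (Fin p) ℝ) (hL : L.det ≠ 0) (μ : Fin p → ℝ)
    (F : (Fin p → ℝ) → ℝ) (c : ℝ)
    (h : HI (fun w => F (L.mulVec w + μ) * ∏ i, nphi (w i)) c) :
    HI (fun x => F x * mvn μ (L * Lᵀ) x) c := by
  -- density identity
  have hLu : IsUnit L.det := isUnit_iff_ne_zero.2 hL
  have hq : ∀ w, mvn μ (L * Lᵀ) (L.mulVec w + μ) = |L.det|⁻¹ * ∏ i, nphi (w i) := by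
    intro w
    unfold mvn nphi
    rw [add_sub_cancel_right, Finset.prod_mul_distrib, Finset.prod_const, ← Real.exp_sum]
    have e1 : dotProduct (L.mulVec w) ((L * Lᵀ)⁻¹.mulVec (L.mulVec w)) = ∑ i, w i ^ 2 := by
      rw [Matrix.mul_inv_rev, Matrix.mulVec_mulVec, Matrix.mul_assoc, Matrix.nonsing_inv_mul _ hLu,
        Matrix.mul_one, ← Matrix.vecMul_transpose, ← Matrix.dotProduct_mulVec, Matrix.mulVec_mulVec,
        Matrix.mul_nonsing_inv _ (by simpa using hLu), Matrix.one_mulVec]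
      simp [dotProduct, sq]
    have e2 : Real.sqrt (((2 * Real.pi) ^ p * (L * Lᵀ).det)⁻¹) =
        |L.det|⁻¹ * (Real.sqrt (2 * Real.pi))⁻¹ ^ p := by
      rw [Matrix.det_mul, Matrix.det_transpose, ← Real.sqrt_sq (x := |L.det|⁻¹ * (Real.sqrt (2 * Real.pi))⁻¹ ^ p) (by positivity)]
      congr 1
      have h3 : ((Real.sqrt (2 * Real.pi))⁻¹ ^ p) ^ 2 = ((2 * Real.pi) ^ p)⁻¹ := by
        rw [← pow_mul, mul_comm p 2, pow_mul, inv_pow, inv_pow, Real.sq_sqrt (by positivity)]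
      rw [mul_pow (|L.det|⁻¹), h3, inv_pow, sq_abs, mul_inv, sq]
      ring
    rw [e1, e2]
    simp only [Finset.card_univ, Fintype.card_fin]
    rw [mul_assoc]
    congr 4
    rw [← Finset.sum_div, Finset.sum_neg_distrib]
  -- change of variables
  let e : (Fin p → ℝ) ≃ₜ (Fin p → ℝ) :=
    (Homeomorph.mk ⟨Matrix.toLin' L, Matrix.toLin' L⁻¹,
        fun w => by simp [Matrix.mulVec_mulVec, Matrix.nonsing_inv_mul L hLu],
        fun w => by simp [Matrix.mulVec_mulVec, Matrix.mul_nonsing_inv L hLu]⟩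
      (LinearMap.continuous_on_pi (Matrix.toLin' L)) (LinearMap.continuous_on_pi (Matrix.toLin' L⁻¹))).trans
      (Homeomorph.addRight μ)
  have he : ∀ w, e w = L.mulVec w + μ := fun w => rfl
  have hmap : Measure.map e volume = ENNReal.ofReal (|L.det|⁻¹) • volume := by
    have : (e : (Fin p → ℝ) → (Fin p → ℝ)) = (fun x => x + μ) ∘ (Matrix.toLin' L) := rfl
    rw [this, ← Measure.map_map (measurable_add_const μ)
      (LinearMap.continuous_on_pi (Matrix.toLin' L)).measurable,
      Real.map_matrix_volume_pi_eq_smul_volume_pi hL, Measure.map_smul, abs_inv,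
      map_add_right_eq_self]
  have hpos : 0 < |L.det| := abs_pos.2 hL
  have hvol : (volume : Measure (Fin p → ℝ)) = ENNReal.ofReal |L.det| • Measure.map e volume := by
    rw [hmap, smul_smul, ← ENNReal.ofReal_mul hpos.le, mul_inv_cancel₀ hpos.ne']; simp
  have hF : ∀ w, F (e w) * mvn μ (L * Lᵀ) (e w) =
      |L.det|⁻¹ * (F (L.mulVec w + μ) * ∏ i, nphi (w i)) := by
    intro w; rw [he, hq]; ring
  constructor
  · rw [hvol]
    refine Integrable.smul_measure ?_ ENNReal.ofReal_ne_top
    rw [e.measurableEmbedding.integrable_map_iff]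
    exact (h.1.const_mul |L.det|⁻¹).congr (ae_of_all _ fun w => (hF w).symm)
  · rw [hvol, integral_smul_measure, e.measurableEmbedding.integral_map]
    simp_rw [hF]
    rw [integral_const_mul, h.2, ENNReal.toReal_ofReal hpos.le, smul_eq_mul,
      mul_inv_cancel_left₀ hpos.ne']

open scoped MatrixOrder in
lemma gauss_moment {p k : ℕ} (Λ : Matrix (Fin p) (Fin p) ℝ) (hΛ : Λ.PosDef) (μ : Fin p → ℝ)
    (M : Matrix (Fin k) (Fin p) ℝ) (B : Fin p → ℝ) :
    HI (fun x => normSq (M.mulVec (x - B)) * mvn μ Λ x)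
      (normSq (M.mulVec (μ - B)) + Matrix.trace (M * Λ * Mᵀ)) := by
  obtain ⟨K, hK⟩ := (CStarAlgebra.nonneg_iff_eq_star_mul_self (a := Λ)).1 hΛ.posSemidef.nonneg
  obtain ⟨L, rfl⟩ : ∃ L : Matrix (Fin p) (Fin p) ℝ, Λ = L * Lᵀ := ⟨Kᵀ, by
    rw [hK, Matrix.transpose_transpose, Matrix.star_eq_conjTranspose, Matrix.conjTranspose_eq_transpose_of_trivial]⟩
  have hL : L.det ≠ 0 := by
    intro h
    have := hΛ.det_pos
    simp [h] at this
  refine gauss_change L hL μ (fun x => normSq (M.mulVec (x - B))) _ ?_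
  have := moment (fun _ => nphi) (fun _ : Fin p => 0) (fun _ => 1)
    (fun _ => ⟨nphi_int, nphi_integral⟩) (fun _ => ⟨nphi_int1, nphi_integral1⟩)
    (fun _ => ⟨nphi_int2, by simpa using nphi_integral2⟩) (M * L) (M.mulVec (μ - B))
  refine this.congr (fun w => ?_) ?_
  · rw [← Matrix.mulVec_mulVec, ← Matrix.mulVec_add, add_sub_assoc]
  · have h0 : (fun _ : Fin p => (0:ℝ)) = 0 := rfl
    rw [h0, Matrix.mulVec_zero, zero_add]
    congr 1
    have : M * (L * Lᵀ) * Mᵀ = (M * L) * (M * L)ᵀ := by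
      simp [Matrix.transpose_mul, Matrix.mul_assoc]
    rw [this]
    generalize M * L = P
    simp [Matrix.trace, Matrix.mul_apply, sq]

lemma normSq_nonneg {m : ℕ} (x : Fin m → ℝ) : 0 ≤ normSq x :=
  Finset.sum_nonneg fun i _ => sq_nonneg (x i)

lemma normSq_cont {m : ℕ} : Continuous (normSq : (Fin m → ℝ) → ℝ) := by
  unfold normSq; fun_prop

lemma mvn_nonneg {p : ℕ} (μ : Fin p → ℝ) (Λ : Matrix (Fin p) (Fin p) ℝ) (x : Fin p → ℝ) :
    0 ≤ mvn μ Λ x := by unfold mvn; positivity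

lemma trace_bound {n p k : ℕ} (X : Matrix (Fin n) (Fin p) ℝ) (Q : Matrix (Fin p) (Fin p) ℝ)
    (hQ : Q.PosSemidef) (hS : (Xᵀ * X + Q).PosDef) (M : Matrix (Fin k) (Fin p) ℝ)
    (s : Fin n → ℝ) (hs : ∀ i, s i ≤ 1) :
    ∑ r, ∑ i, (M * (Xᵀ * X + Q)⁻¹ * Xᵀ) r i ^ 2 * s i ≤ Matrix.trace (M * (Xᵀ * X + Q)⁻¹ * Mᵀ) := by
  set S := Xᵀ * X + Q with hSd
  have hu : IsUnit S.det := isUnit_iff_ne_zero.2 hS.det_pos.ne'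
  have hT : (S⁻¹)ᵀ = S⁻¹ := by
    have := hS.inv.isHermitian
    rwa [Matrix.IsHermitian, Matrix.conjTranspose_eq_transpose_of_trivial] at this
  have h1 : ∑ r, ∑ i, (M * S⁻¹ * Xᵀ) r i ^ 2 * s i ≤ Matrix.trace ((M * S⁻¹ * Xᵀ) * (M * S⁻¹ * Xᵀ)ᵀ) := by
    simp only [Matrix.trace, Matrix.diag, Matrix.mul_apply (M := M * S⁻¹ * Xᵀ), Matrix.transpose_apply (M * S⁻¹ * Xᵀ)]
    refine Finset.sum_le_sum fun r _ => Finset.sum_le_sum fun i _ => ?_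
    rw [← sq]
    exact mul_le_of_le_one_right (sq_nonneg _) (hs i)
  have h2 : 0 ≤ Matrix.trace ((M * S⁻¹) * Q * (M * S⁻¹)ᵀ) := by
    have := (hQ.mul_mul_conjTranspose_same (M * S⁻¹)).trace_nonneg
    rwa [Matrix.conjTranspose_eq_transpose_of_trivial] at this
  have h3 : (M * S⁻¹ * Xᵀ) * (M * S⁻¹ * Xᵀ)ᵀ + (M * S⁻¹) * Q * (M * S⁻¹)ᵀ = M * S⁻¹ * Mᵀ := by
    have : (M * S⁻¹ * Xᵀ) * (M * S⁻¹ * Xᵀ)ᵀ + (M * S⁻¹) * Q * (M * S⁻¹)ᵀ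
        = M * S⁻¹ * (S * S⁻¹) * Mᵀ := by
      have hS3 : S * (S⁻¹ * Mᵀ) = Xᵀ * (X * (S⁻¹ * Mᵀ)) + Q * (S⁻¹ * Mᵀ) := by
        generalize S⁻¹ * Mᵀ = R
        rw [hSd, Matrix.add_mul, Matrix.mul_assoc]
      simp only [Matrix.transpose_mul, Matrix.transpose_transpose, hT, Matrix.mul_assoc, hS3,
        Matrix.mul_add]
    rw [this, Matrix.mul_nonsing_inv _ hu, Matrix.mul_one]
  rw [← h3, Matrix.trace_add]
  linarith

lemma drift_eq {n p k : ℕ} (X : Matrix (Fin n) (Fin p) ℝ) (Y : Fin n → Bool)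
    (v : Fin p → ℝ) (Q : Matrix (Fin p) (Fin p) ℝ) (hS : (Xᵀ * X + Q).PosDef)
    (B : Fin p → ℝ) (M : Matrix (Fin k) (Fin p) ℝ) (β : Fin p → ℝ) :
    ∫ β' : Fin p → ℝ, normSq (M.mulVec (β' - B)) * kAC X Y v Q β β' =
      normSq ((M * (Xᵀ * X + Q)⁻¹ * Xᵀ).mulVec (fun i => tmean (dotProduct (X i) β) (Y i))
        + M.mulVec ((Xᵀ * X + Q)⁻¹.mulVec (Q.mulVec v) - B))
      + ∑ r, ∑ i, (M * (Xᵀ * X + Q)⁻¹ * Xᵀ) r i ^ 2 * tvar (dotProduct (X i) β) (Y i)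
      + Matrix.trace (M * (Xᵀ * X + Q)⁻¹ * Mᵀ) := by
  set S := Xᵀ * X + Q with hSd
  set μ : (Fin n → ℝ) → (Fin p → ℝ) := fun z => S⁻¹.mulVec (Xᵀ.mulVec z + Q.mulVec v) with hμ
  set T : (Fin n → ℝ) → ℝ := fun z => ∏ i, tn (dotProduct (X i) β) (Y i) (z i) with hT
  set c := M.mulVec (S⁻¹.mulVec (Q.mulVec v) - B) with hc
  have hT0 : ∀ z, 0 ≤ T z := fun z => Finset.prod_nonneg fun i _ => tn_nonneg _ _ _
  have hTm : Measurable T :=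
    Finset.measurable_prod _ fun i _ => (tn_meas _ _).comp (measurable_pi_apply i)
  have hMμ : ∀ z, M.mulVec (μ z - B) = (M * S⁻¹ * Xᵀ).mulVec z + c := by
    intro z
    simp only [hμ, hc, Matrix.mulVec_add, Matrix.mulVec_sub, Matrix.mulVec_mulVec, Matrix.mul_assoc]
    abel
  have hin : ∀ z, HI (fun β' => normSq (M.mulVec (β' - B)) * (mvn (μ z) S⁻¹ β' * T z))
      (T z * (normSq ((M * S⁻¹ * Xᵀ).mulVec z + c) + Matrix.trace (M * S⁻¹ * Mᵀ))) := by
    intro z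
    refine ((gauss_moment S⁻¹ hS.inv (μ z) M B).mul (T z)).congr (fun x => by ring) ?_
    rw [hMμ]
  have hout : HI (fun z => T z * (normSq ((M * S⁻¹ * Xᵀ).mulVec z + c) + Matrix.trace (M * S⁻¹ * Mᵀ)))
      (normSq ((M * S⁻¹ * Xᵀ).mulVec (fun i => tmean (dotProduct (X i) β) (Y i)) + c)
      + ∑ r, ∑ i, (M * S⁻¹ * Xᵀ) r i ^ 2 * tvar (dotProduct (X i) β) (Y i)
      + Matrix.trace (M * S⁻¹ * Mᵀ)) := by
    have a := moment (fun i => tn (dotProduct (X i) β) (Y i)) (fun i => tmean (dotProduct (X i) β) (Y i))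
      (fun i => tvar (dotProduct (X i) β) (Y i)) (fun i => (tn_facts _ _).1) (fun i => (tn_facts _ _).2.1)
      (fun i => by
        have := (tn_facts (dotProduct (X i) β) (Y i)).2.2
        refine ⟨this.1, this.2.trans ?_⟩
        unfold tvar; ring) (M * S⁻¹ * Xᵀ) c
    have b : HI T 1 := (HI.prod (c := fun _ => 1) fun i => (tn_facts (dotProduct (X i) β) (Y i)).1).congr
      (fun z => rfl) (by simp)
    refine (a.add (b.mul (Matrix.trace (M * S⁻¹ * Mᵀ)))).congr (fun z => ?_) (by ring)
    simp only [hT]; ring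
  have hint : Integrable (Function.uncurry fun (z : Fin n → ℝ) (β' : Fin p → ℝ) =>
      normSq (M.mulVec (β' - B)) * (mvn (μ z) S⁻¹ β' * T z)) (volume.prod volume) := by
    rw [integrable_prod_iff]
    · refine ⟨ae_of_all _ fun z => (hin z).1, ?_⟩
      refine hout.1.congr (ae_of_all _ fun z => ?_)
      simp only [Function.uncurry_apply_pair]
      rw [← (hin z).2]
      refine integral_congr_ae (ae_of_all _ fun x => ?_)
      simp only
      rw [Real.norm_of_nonneg]
      exact mul_nonneg (normSq_nonneg _) (mul_nonneg (mvn_nonneg _ _ _) (hT0 z))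
    · refine Measurable.aestronglyMeasurable ?_
      have hμc : Continuous μ := by
        simp only [hμ]; fun_prop
      have c1 : Continuous (fun q : (Fin n → ℝ) × (Fin p → ℝ) => normSq (M.mulVec (q.2 - B))) :=
        normSq_cont.comp (by fun_prop)
      have c2 : Continuous (fun q : (Fin n → ℝ) × (Fin p → ℝ) => mvn (μ q.1) S⁻¹ q.2) := by
        unfold mvn
        fun_prop
      exact c1.measurable.mul (c2.measurable.mul (hTm.comp measurable_fst))
  have e : ∀ β', normSq (M.mulVec (β' - B)) * kAC X Y v Q β β' =
      ∫ z, normSq (M.mulVec (β' - B)) * (mvn (μ z) S⁻¹ β' * T z) := by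
    intro β'
    rw [integral_const_mul]; rfl
  simp_rw [e]
  rw [← integral_integral_swap hint, ← hout.2]
  exact integral_congr_ae (ae_of_all _ fun z => (hin z).2)

lemma mvt {n k : ℕ} (A : Matrix (Fin k) (Fin n) ℝ) (h h' : ℝ → Fin n → ℝ)
    (hd : ∀ t i, HasDerivAt (fun t => h t i) (h' t i) t) :
    ∃ t ∈ Set.Ioo (0:ℝ) 1, normSq (A.mulVec (h 1 - h 0)) ≤ normSq (A.mulVec (h' t)) := by
  set u := A.mulVec (h 1 - h 0) with hu
  have hD : ∀ t, HasDerivAt (fun t => dotProduct u (A.mulVec (h t))) (dotProduct u (A.mulVec (h' t))) t := by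
    intro t
    simp only [dotProduct, Matrix.mulVec]
    exact HasDerivAt.fun_sum fun r _ => (HasDerivAt.fun_sum fun i _ => (hd t i).const_mul _).const_mul _
  obtain ⟨t, ht, he⟩ := exists_hasDerivAt_eq_slope _ _ (zero_lt_one (α := ℝ))
    (fun t _ => (hD t).continuousAt.continuousWithinAt) (fun t _ => hD t)
  refine ⟨t, ht, ?_⟩
  rw [sub_zero, div_one, ← dotProduct_sub, ← Matrix.mulVec_sub, ← hu] at he
  have h1 : dotProduct u u = normSq u := by simp [dotProduct, normSq, sq]
  rw [h1] at he
  have h2 : dotProduct u (A.mulVec (h' t)) ^ 2 ≤ normSq u * normSq (A.mulVec (h' t)) :=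
    Finset.sum_mul_sq_le_sq_mul_sq _ _ _
  rw [he, sq] at h2
  rcases (normSq_nonneg u).eq_or_lt with h0 | h0
  · rw [← h0]; exact normSq_nonneg _
  · exact le_of_mul_le_mul_left h2 h0

/-- the generic drift inequality for V(β) = ‖M(β − B̂)‖². -/
theorem generic_drift_inequality
    (n p m' : ℕ) (hn : 1 ≤ n) (hp : 1 ≤ p)
    (X : Matrix (Fin n) (Fin p) ℝ) (Y : Fin n → Bool)
    (v : Fin p → ℝ) (Q : Matrix (Fin p) (Fin p) ℝ) (hQ : Q.PosSemidef)
    (hSig : IsUnit (Xᵀ * X + Q).det)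
    (Bhat : Fin p → ℝ) (hmode : IsPosteriorMode X Y v Q Bhat)
    (M : Matrix (Fin m') (Fin p) ℝ) (β : Fin p → ℝ) :
    (∫ β' : Fin p → ℝ, normSq (M.mulVec (β' - Bhat)) * kAC X Y v Q β β')
      ≤ sSup {r : ℝ | ∃ t ∈ Set.Ioo (0 : ℝ) 1,
            r = normSq ((M * (Xᵀ * X + Q)⁻¹ * Xᵀ * Dmat X Y (Bhat + t • (β - Bhat)) * X).mulVec
                  (β - Bhat))}
        + 2 * Matrix.trace (M * (Xᵀ * X + Q)⁻¹ * Mᵀ) := by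
  have hS : (Xᵀ * X + Q).PosDef := by
    have h1 : (Xᵀ * X).PosSemidef := by
      have := Matrix.posSemidef_conjTranspose_mul_self X
      rwa [Matrix.conjTranspose_eq_transpose_of_trivial] at this
    exact (h1.add hQ).posDef_iff_det_ne_zero.2 hSig.ne_zero
  rw [drift_eq X Y v Q hS]
  have htr := trace_bound X Q hQ hS M (fun i => tvar (dotProduct (X i) β) (Y i)) (fun i => tvar_le _ _)
  set S := Xᵀ * X + Q with hSd
  set h : ℝ → Fin n → ℝ := fun t i => tmean (dotProduct (X i) (Bhat + t • (β - Bhat))) (Y i) with hh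
  -- the mode is a fixed point
  have hfix : Xᵀ.mulVec (h 0) + Q.mulVec v = S.mulVec Bhat := by
    unfold IsPosteriorMode at hmode
    rw [Matrix.mulVec_sub] at hmode
    have e1 : Xᵀ.mulVec (h 0) = Xᵀ.mulVec (X.mulVec Bhat) +
        ∑ i, (if Y i then nphi (dotProduct (X i) Bhat) / nPhi (dotProduct (X i) Bhat)
          else -(nphi (dotProduct (X i) Bhat) / (1 - nPhi (dotProduct (X i) Bhat)))) • X i := by
      funext j
      simp only [hh, tmean, zero_smul, add_zero, Matrix.mulVec, Pi.add_apply, Finset.sum_apply, Pi.smul_apply,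
        smul_eq_mul]
      simp only [dotProduct, Matrix.transpose_apply, mul_add, Finset.sum_add_distrib]
      congr 1
      exact Finset.sum_congr rfl fun i _ => mul_comm _ _
    rw [e1, hSd, Matrix.add_mulVec, ← Matrix.mulVec_mulVec]
    funext j
    have := congrFun hmode j
    simp only [Pi.add_apply, Pi.sub_apply, Pi.zero_apply] at this ⊢
    linarith
  have hfirst : (M * S⁻¹ * Xᵀ).mulVec (fun i => tmean (dotProduct (X i) β) (Y i))
        + M.mulVec (S⁻¹.mulVec (Q.mulVec v) - Bhat) = (M * S⁻¹ * Xᵀ).mulVec (h 1 - h 0) := by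
    have e1 : (fun i => tmean (dotProduct (X i) β) (Y i)) = h 1 := by
      funext i; simp [hh]
    have e2 : Bhat = S⁻¹.mulVec (Xᵀ.mulVec (h 0) + Q.mulVec v) := by
      rw [hfix, Matrix.mulVec_mulVec, Matrix.nonsing_inv_mul _ hSig, Matrix.one_mulVec]
    rw [e1]
    conv_lhs => rw [e2]
    simp only [Matrix.mulVec_add, Matrix.mulVec_sub, Matrix.mulVec_mulVec, Matrix.mul_assoc]
    abel
  rw [hfirst]
  set g : ℝ → Fin n → ℝ := fun t => (Dmat X Y (Bhat + t • (β - Bhat))).mulVec (X.mulVec (β - Bhat)) with hg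
  have hgi : ∀ t i, g t i = (1 - (if Y i then gfun (dotProduct (X i) (Bhat + t • (β - Bhat)))
      else gfun (-(dotProduct (X i) (Bhat + t • (β - Bhat)))))) * dotProduct (X i) (β - Bhat) := by
    intro t i
    simp only [hg, Dmat, Matrix.mulVec_diagonal]; rfl
  have hset : ∀ t : ℝ, (M * S⁻¹ * Xᵀ * Dmat X Y (Bhat + t • (β - Bhat)) * X).mulVec (β - Bhat) =
      (M * S⁻¹ * Xᵀ).mulVec (g t) := by
    intro t
    simp only [hg, Matrix.mulVec_mulVec, Matrix.mul_assoc]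
  simp_rw [hset]
  obtain ⟨t, ht, hle⟩ := mvt (M * S⁻¹ * Xᵀ) h g (by
    intro t i
    rw [hgi]
    have hl : HasDerivAt (fun t : ℝ => dotProduct (X i) (Bhat + t • (β - Bhat)))
        (dotProduct (X i) (β - Bhat)) t := by
      simp only [dotProduct_add, dotProduct_smul, smul_eq_mul]
      simpa using ((hasDerivAt_id t).mul_const (dotProduct (X i) (β - Bhat))).const_add
        (dotProduct (X i) Bhat)
    exact (tmean_deriv _ (Y i)).comp t hl)
  have hgc : Continuous fun t => normSq ((M * S⁻¹ * Xᵀ).mulVec (g t)) := by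
    have : Continuous g := by
      refine continuous_pi fun i => ?_
      simp only [hgi]
      have := gfun_cont
      have hl : Continuous (fun t : ℝ => dotProduct (X i) (Bhat + t • (β - Bhat))) := by fun_prop
      split_ifs <;> fun_prop
    exact normSq_cont.comp (by fun_prop)
  have hbdd : BddAbove {r : ℝ | ∃ t ∈ Set.Ioo (0 : ℝ) 1, r = normSq ((M * S⁻¹ * Xᵀ).mulVec (g t))} := by
    refine ((isCompact_Icc (a := (0:ℝ)) (b := 1)).image hgc).bddAbove.mono ?_
    rintro r ⟨t, ht, rfl⟩
    exact ⟨t, Set.Ioo_subset_Icc_self ht, rfl⟩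
  have := le_csSup hbdd ⟨t, ht, rfl⟩
  linarith
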